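/- arXiv:0910.3527 — 2 statements merged into one kernel-verified Lean document; each statement's English description precedes it below -/
import Mathlib

section
/- Let f : ℂⁿ → ℂⁿ be complex differentiable on an open set U containing a real point c₀ ∈ ℝⁿ, and suppose f maps real points of U to real vectors. Then the componentwise imaginary part satisfies lim_{δ→0⁺} Im[ f(c₀ + iδ f(c₀)) ] / δ = Df(c₀)[ f(c₀) ], i.e., the complex-step approximation recovers the directional derivative of the vector field f in its own direction (the quantity c̈ = J_f(c₀) f(c₀) for the ODE ċ = f(c)). -/
open Topology Filter

/-- The complex-step approximation recovers the directional derivative of a vector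
field in its own direction: if `f : ℂⁿ → ℂⁿ` is complex differentiable on an open set
containing the real point `c₀` and maps real points to real vectors, then
`Im[f(c₀ + iδ f(c₀))]/δ → Df(c₀)[f(c₀)]` (componentwise) as `δ → 0⁺`. -/
theorem complex_step_directional_derivative
    {n : ℕ} (f : (Fin n → ℂ) → (Fin n → ℂ)) (U : Set (Fin n → ℂ)) (hU : IsOpen U)
    (c₀ : Fin n → ℝ) (hc₀ : (fun i => (c₀ i : ℂ)) ∈ U)
    (hf : DifferentiableOn ℂ f U)
    (hreal : ∀ z ∈ U, (∀ i, (z i).im = 0) → ∀ i, (f z i).im = 0) :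
    Tendsto
      (fun δ : ℝ => fun i : Fin n =>
        (((f ((fun i => (c₀ i : ℂ)) + ((δ : ℂ) * Complex.I) • f (fun i => (c₀ i : ℂ))) i).im
          / δ : ℝ) : ℂ))
      (𝓝[>] 0)
      (𝓝 (fderiv ℂ f (fun i => (c₀ i : ℂ)) (f (fun i => (c₀ i : ℂ))))) := by
  set c : Fin n → ℂ := fun i => (c₀ i : ℂ) with hc
  have hcU : U ∈ 𝓝 c := hU.mem_nhds hc₀
  have hd : HasFDerivAt f (fderiv ℂ f c) c := (hf.differentiableAt hcU).hasFDerivAt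
  have him : ∀ i, (f c i).im = 0 := hreal c hc₀ (fun i => by simp [hc])
  -- derivative along a complex line `c + (t a) f(c)`
  have key : ∀ (a : ℂ) (i : Fin n),
      HasDerivAt (fun t : ℝ => (f (c + ((t : ℂ) * a) • f c) i).im)
        (a * fderiv ℂ f c (f c) i).im 0 := by
    intro a i
    have h1 : HasDerivAt (fun w : ℂ => c + (w * a) • f c) (a • f c) ((0 : ℝ) : ℂ) := by
      have h := (((hasDerivAt_id ((0 : ℝ) : ℂ)).mul_const a).smul_const (f c)).const_add c
      simpa using h
    have h2 : HasFDerivAt f (fderiv ℂ f c) (c + ((((0 : ℝ) : ℂ)) * a) • f c) := by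
      simpa using hd
    have h3 := h2.comp_hasDerivAt ((0 : ℝ) : ℂ) h1
    have h4 := ((hasDerivAt_pi.1 h3) i).comp_ofReal
    have h5 := Complex.imCLM.hasFDerivAt.comp_hasDerivAt (0 : ℝ) h4
    simpa [Function.comp_def] using h5
  rw [tendsto_pi_nhds]
  intro i
  have hdim : (fderiv ℂ f c (f c) i).im = 0 := by
    have h := key 1 i
    have hz : (fun t : ℝ => (f (c + ((t : ℂ) * 1) • f c) i).im) =ᶠ[𝓝 0] fun _ => (0 : ℝ) := by
      have hcont : Tendsto (fun t : ℝ => c + ((t : ℂ) * 1) • f c) (𝓝 0) (𝓝 c) := by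
        have : Continuous (fun t : ℝ => c + ((t : ℂ) * 1) • f c) := by fun_prop
        simpa using this.tendsto 0
      filter_upwards [hcont hcU] with t ht
      exact hreal _ ht (fun j => by simp [hc]; exact Or.inr (him j)) i
    have h' := (hasDerivAt_const (0 : ℝ) (0 : ℝ)).congr_of_eventuallyEq hz
    simpa using h.unique h'
  have hI := (key Complex.I i).tendsto_slope_zero_right
  have hlim : (fderiv ℂ f c (f c) i) = (((Complex.I * fderiv ℂ f c (f c) i).im : ℝ) : ℂ) := by
    apply Complex.ext <;> simp [hdim]
  rw [hlim]
  refine (Complex.continuous_ofReal.tendsto _).comp (hI.congr fun t => ?_)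
  simp [him i, div_eq_inv_mul]
end

section
/- Let γ > 1 and let (y₁, y₂) : [0,∞) → ℝ² be a solution of the Davis–Skodje system with y₁(0) > −1 and y₁(t) ≠ −1 for all t ≥ 0. If the initial value lies on the graph of h(y₁) = y₁/(1+y₁), i.e., y₂(0) = y₁(0)/(1+y₁(0)), then y₂(t) = y₁(t)/(1+y₁(t)) for all t ≥ 0. In other words, the curve {(y₁, y₁/(1+y₁)) : y₁ > −1} is a positively invariant manifold (the slow invariant manifold) of the Davis–Skodje system. -/
/-- Positive invariance of the slow invariant manifold `{y₂ = y₁/(1+y₁)}` of the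
Davis–Skodje system: a solution starting on the graph of `h(y₁) = y₁/(1+y₁)`
remains on it for all `t ≥ 0`. -/
theorem davis_skodje_sim_positively_invariant
    (γ : ℝ) (hγ : 1 < γ) (y₁ y₂ : ℝ → ℝ)
    (hinit : -1 < y₁ 0)
    (hne : ∀ t : ℝ, 0 ≤ t → y₁ t ≠ -1)
    (h1 : ∀ t : ℝ, 0 ≤ t → HasDerivAt y₁ (-(y₁ t)) t)
    (h2 : ∀ t : ℝ, 0 ≤ t → HasDerivAt y₂
      (-γ * y₂ t + ((γ - 1) * y₁ t + γ * (y₁ t) ^ 2) / (1 + y₁ t) ^ 2) t)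
    (h0 : y₂ 0 = y₁ 0 / (1 + y₁ 0)) :
    ∀ t : ℝ, 0 ≤ t → y₂ t = y₁ t / (1 + y₁ t) := by
  have key : ∀ s : ℝ, 0 ≤ s →
      HasDerivAt (fun s => (y₂ s - y₁ s / (1 + y₁ s)) * Real.exp (γ * s)) 0 s := by
    intro s hs
    have hn : 1 + y₁ s ≠ 0 := fun h => hne s hs (by linarith)
    have hq := (h1 s hs).fun_div ((h1 s hs).const_add 1) hn
    have he : HasDerivAt (fun s => Real.exp (γ * s)) (Real.exp (γ * s) * (γ * 1)) s :=
      ((hasDerivAt_id' s).const_mul γ).exp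
    have hm := ((h2 s hs).fun_sub hq).fun_mul he
    refine hm.congr_deriv ?_
    field_simp
    ring
  intro t ht
  have hc := constant_of_has_deriv_right_zero
    (f := fun s => (y₂ s - y₁ s / (1 + y₁ s)) * Real.exp (γ * s)) (a := 0) (b := t)
    (fun s hs => (key s hs.1).continuousAt.continuousWithinAt)
    (fun s hs => (key s hs.1).hasDerivWithinAt) t ⟨ht, le_refl t⟩
  have hz : (y₂ t - y₁ t / (1 + y₁ t)) * Real.exp (γ * t) = 0 := by
    simpa [h0] using hc
  rcases mul_eq_zero.mp hz with h | h
  · linarith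
  · exact absurd h (Real.exp_pos _).ne'
end
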